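/- Fix i₀ ∈ V. On the probability space (ℝ^V, ν_V^W), the random variable γ := 1/(2·(H_β^{-1})(i₀,i₀)) has the Gamma(1/2,1) distribution, i.e. the pushforward of ν_V^W under β ↦ 1/(2·(H_β^{-1})(i₀,i₀)) has density γ ↦ 1_{γ>0}·e^{−γ}/√(πγ) with respect to Lebesgue measure; moreover γ is independent of the random vector (β_i)_{i∈V∖{i₀}}. -/

import Mathlib

open MeasureTheory Matrix

noncomputable section

/-- The Schrödinger operator `H_β = 2·diag(β) − W`. -/
def Hmat {V : Type*} [Fintype V] [DecidableEq V] (W : Matrix V V ℝ) (β : V → ℝ) :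
    Matrix V V ℝ :=
  2 • Matrix.diagonal β - W

/-- Density of the measure `ν_V^{W,η}` with respect to Lebesgue measure. -/
def nuDens {V : Type*} [Fintype V] [DecidableEq V] (W : Matrix V V ℝ) (η : V → ℝ)
    (β : V → ℝ) : ENNReal :=
  Set.indicator {β : V → ℝ | (Hmat W β).PosDef}
    (fun β => ENNReal.ofReal
      ((2 / Real.pi) ^ ((Fintype.card V : ℝ) / 2) *
        Real.exp (-(1 / 2) * ((1 : V → ℝ) ⬝ᵥ (Hmat W β).mulVec 1
            + η ⬝ᵥ (Hmat W β)⁻¹.mulVec η) + η ⬝ᵥ (1 : V → ℝ)) /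
        Real.sqrt (Hmat W β).det)) β

/-- The measure `ν_V^{W,η}`. -/
def nuMeas {V : Type*} [Fintype V] [DecidableEq V] (W : Matrix V V ℝ) (η : V → ℝ) :
    Measure (V → ℝ) :=
  volume.withDensity (nuDens W η)

/-- The graph on `V` with an edge `{i,j}` whenever `W i j > 0`. -/
def graphOf {V : Type*} (W : Matrix V V ℝ) : SimpleGraph V :=
  SimpleGraph.fromRel (fun i j => 0 < W i j)



def blk {m : Type*} (A : Matrix m m ℝ) (w : m → ℝ) (d : ℝ) : Matrix (m ⊕ Unit) (m ⊕ Unit) ℝ :=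
  fromBlocks A (-replicateCol Unit w) (-replicateRow Unit w) (diagonal (fun _ => d))

lemma blk_det {m : Type*} [Fintype m] [DecidableEq m] (A : Matrix m m ℝ) (hA : A.PosDef) (w : m → ℝ) (d : ℝ) :
    (blk A w d).det = A.det * (d - w ⬝ᵥ A⁻¹ *ᵥ w) := by
  have := hA.isUnit.invertible
  rw [blk, det_fromBlocks₁₁]
  congr 1
  rw [det_unique]
  simp only [Matrix.sub_apply, invOf_eq_nonsing_inv, Matrix.neg_mul, Matrix.mul_neg, neg_neg]
  congr 1
  rw [Matrix.mul_assoc]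
  simp [Matrix.mul_apply, dotProduct, mulVec]

lemma blk_posDef {m : Type*} [Fintype m] [DecidableEq m] (A : Matrix m m ℝ) (hA : A.PosDef) (w : m → ℝ) (d : ℝ) :
    (blk A w d).PosDef ↔ 0 < d - w ⬝ᵥ A⁻¹ *ᵥ w := by
  have := hA.isUnit.invertible
  have hdet := blk_det A hA w d
  constructor
  · intro h
    have := h.det_pos
    rw [hdet] at this
    exact (pos_iff_pos_of_mul_pos this).1 hA.det_pos
  · intro h
    have hs : (blk A w d).PosSemidef := by
      have e : (-replicateRow Unit w) = (-replicateCol Unit w)ᴴ := by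
        ext; simp
      rw [blk, e, PosDef.fromBlocks₁₁ _ _ hA]
      have : ((diagonal (fun _ => d) : Matrix Unit Unit ℝ) - (-replicateCol Unit w)ᴴ * A⁻¹ * (-replicateCol Unit w)) = diagonal (fun _ => d - w ⬝ᵥ A⁻¹ *ᵥ w) := by
        ext i j
        rw [Matrix.mul_assoc]
        simp [Matrix.mul_apply, dotProduct, mulVec]
      rw [this]
      exact PosSemidef.diagonal (fun _ => h.le)
    rw [hs.posDef_iff_det_ne_zero, hdet]
    exact (mul_pos hA.det_pos h).ne'

lemma blk_inv_mulVec {m : Type*} [Fintype m] [DecidableEq m] (A : Matrix m m ℝ) (hA : A.PosDef) (w : m → ℝ) (d : ℝ)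
    (hs : 0 < d - w ⬝ᵥ A⁻¹ *ᵥ w) (u : m → ℝ) (t : ℝ) :
    (blk A w d)⁻¹ *ᵥ (Sum.elim u (fun _ => t)) =
      Sum.elim (A⁻¹ *ᵥ u + ((t + w ⬝ᵥ A⁻¹ *ᵥ u) / (d - w ⬝ᵥ A⁻¹ *ᵥ w)) • A⁻¹ *ᵥ w)
        (fun _ => (t + w ⬝ᵥ A⁻¹ *ᵥ u) / (d - w ⬝ᵥ A⁻¹ *ᵥ w)) := by
  have := hA.isUnit.invertible
  have hM := (blk_posDef A hA w d).2 hs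
  have := hM.isUnit.invertible
  have key : Sum.elim u (fun _ => t) = (blk A w d) *ᵥ Sum.elim (A⁻¹ *ᵥ u + ((t + w ⬝ᵥ A⁻¹ *ᵥ u) / (d - w ⬝ᵥ A⁻¹ *ᵥ w)) • A⁻¹ *ᵥ w)
        (fun _ => (t + w ⬝ᵥ A⁻¹ *ᵥ u) / (d - w ⬝ᵥ A⁻¹ *ᵥ w)) := by
    set s := d - w ⬝ᵥ A⁻¹ *ᵥ w with hs'
    set y := (t + w ⬝ᵥ A⁻¹ *ᵥ u) / s with hy
    rw [blk, fromBlocks_mulVec]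
    have hys : y * s = t + w ⬝ᵥ A⁻¹ *ᵥ u := by rw [hy]; field_simp
    congr 1
    · ext i
      simp only [mulVec_add, mulVec_smul, mulVec_mulVec, Sum.elim_comp_inl, Sum.elim_comp_inr, Matrix.mul_inv_of_invertible, one_mulVec]
      simp [mulVec, dotProduct, mul_comm]
    · ext i
      have : ((-replicateRow Unit w) *ᵥ (A⁻¹ *ᵥ u + y • A⁻¹ *ᵥ w)) i = - (w ⬝ᵥ (A⁻¹ *ᵥ u + y • A⁻¹ *ᵥ w)) := by
        simp [mulVec, dotProduct]
      simp only [Sum.elim_comp_inl, Sum.elim_comp_inr, Pi.add_apply, this]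
      simp only [dotProduct_add, dotProduct_smul, smul_eq_mul]
      have : ((diagonal (fun _ => d) : Matrix Unit Unit ℝ) *ᵥ fun x => y) i = d * y := by simp [mulVec, dotProduct]
      rw [this]
      rw [hs'] at hys
      linear_combination -hys
  conv_lhs => rw [key]
  rw [mulVec_mulVec, Matrix.inv_mul_of_invertible, one_mulVec]

lemma blk_inv_quad {m : Type*} [Fintype m] [DecidableEq m] (A : Matrix m m ℝ) (hA : A.PosDef) (w : m → ℝ) (d : ℝ)
    (hs : 0 < d - w ⬝ᵥ A⁻¹ *ᵥ w) (u : m → ℝ) (t : ℝ) :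
    (Sum.elim u (fun _ => t)) ⬝ᵥ (blk A w d)⁻¹ *ᵥ (Sum.elim u (fun _ => t)) =
      u ⬝ᵥ A⁻¹ *ᵥ u + (t + w ⬝ᵥ A⁻¹ *ᵥ u)^2 / (d - w ⬝ᵥ A⁻¹ *ᵥ w) := by
  rw [blk_inv_mulVec A hA w d hs]
  have hsym : u ⬝ᵥ A⁻¹ *ᵥ w = w ⬝ᵥ A⁻¹ *ᵥ u := by
    rw [dotProduct_mulVec, ← mulVec_transpose, dotProduct_comm]
    have := hA.isHermitian.inv
    rw [IsHermitian, conjTranspose_eq_transpose_of_trivial] at this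
    rw [this]
  simp only [sumElim_dotProduct_sumElim, dotProduct_add, dotProduct_smul, hsym, smul_eq_mul]
  simp [dotProduct]
  simp only [← dotProduct.eq_1]
  ring

lemma blk_inv_corner {m : Type*} [Fintype m] [DecidableEq m] (A : Matrix m m ℝ) (hA : A.PosDef) (w : m → ℝ) (d : ℝ)
    (hs : 0 < d - w ⬝ᵥ A⁻¹ *ᵥ w) :
    (blk A w d)⁻¹ (Sum.inr ()) (Sum.inr ()) = 1 / (d - w ⬝ᵥ A⁻¹ *ᵥ w) := by
  have := congrFun (blk_inv_mulVec A hA w d hs 0 1) (Sum.inr ())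
  simpa [mulVec, dotProduct] using this

lemma blk_one_quad {m : Type*} [Fintype m] [DecidableEq m] (A : Matrix m m ℝ) (w : m → ℝ) (d : ℝ) :
    (1 : m ⊕ Unit → ℝ) ⬝ᵥ (blk A w d) *ᵥ 1 = 1 ⬝ᵥ A *ᵥ 1 - 2 * (w ⬝ᵥ 1) + d := by
  simp [blk, mulVec, dotProduct, Finset.sum_add_distrib]
  ring

lemma inv_nonneg_of_offdiag {m : Type*} [Fintype m] [DecidableEq m] (A : Matrix m m ℝ) (hA : A.PosDef)
    (hoff : ∀ i j, i ≠ j → A i j ≤ 0) (b : m → ℝ) (hb : ∀ i, 0 ≤ b i) (i : m) : 0 ≤ (A⁻¹ *ᵥ b) i := by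
  have := hA.isUnit.invertible
  set x := A⁻¹ *ᵥ b with hx
  have hAx : A *ᵥ x = b := by
    rw [hx, mulVec_mulVec, Matrix.mul_inv_of_invertible, one_mulVec]
  let n : m → ℝ := fun i => max (-x i) 0
  by_contra hneg
  push Not at hneg
  have hn : n ≠ 0 := by
    intro h
    have := congrFun h i
    simp [n] at this
    linarith
  have h1 := hA.dotProduct_mulVec_pos hn
  have h2 : 0 ≤ n ⬝ᵥ A *ᵥ x := by
    rw [hAx]
    exact Finset.sum_nonneg fun i _ => mul_nonneg (le_max_right _ _) (hb i)
  have h3 : n ⬝ᵥ A *ᵥ (x + n) ≤ 0 := by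
    simp only [dotProduct, mulVec, Finset.mul_sum]
    refine Finset.sum_nonpos fun i _ => Finset.sum_nonpos fun j _ => ?_
    have hni : 0 ≤ n i := le_max_right _ _
    have hpj : 0 ≤ (x + n) j := by
      have : -x j ≤ n j := le_max_left _ _
      simp; linarith
    by_cases hij : i = j
    · subst hij
      have : n i = 0 ∨ (x + n) i = 0 := by
        rcases le_total (-x i) 0 with h | h
        · left; simp [n]; linarith
        · right; simp [n]; rw [max_eq_left h]; ring
      rcases this with h | h <;> simp only [h] <;> simp
    · have := hoff i j hij
      exact mul_nonpos_of_nonneg_of_nonpos hni (mul_nonpos_of_nonpos_of_nonneg this hpj)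
  rw [mulVec_add, dotProduct_add] at h3
  simp at h1
  linarith

def gE (u : ℝ) : ENNReal := ENNReal.ofReal (Real.exp (-u ^ 2))

lemma gE_meas : Measurable gE := by unfold gE; fun_prop

lemma gE_neg (u : ℝ) : gE (-u) = gE u := by simp [gE]

lemma lint_gE : ∫⁻ u, gE u = ENNReal.ofReal (√Real.pi) := by
  have h := integral_gaussian 1
  have h2 := integrable_exp_neg_mul_sq (b := 1) one_pos
  have := ofReal_integral_eq_lintegral_ofReal h2 (ae_of_all _ fun x => (Real.exp_pos _).le)
  rw [h] at this
  simpa [gE] using this.symm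

lemma lint_gE_Ioi : ∫⁻ u in Set.Ioi (0:ℝ), gE u = ENNReal.ofReal (√Real.pi / 2) := by
  have h := integral_gaussian_Ioi 1
  have h2 := (integrable_exp_neg_mul_sq (b := 1) one_pos).integrableOn (s := Set.Ioi (0:ℝ))
  have := ofReal_integral_eq_lintegral_ofReal h2 (ae_of_all _ fun x => (Real.exp_pos _).le)
  rw [h] at this
  simpa [gE] using this.symm

lemma glasser (a : ℝ) (ha : 0 ≤ a) :
    ∫⁻ s in Set.Ioi (0:ℝ), gE (s - a / s) = ENNReal.ofReal (√Real.pi / 2) := by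
  rcases ha.eq_or_lt with rfl | ha
  · simpa using lint_gE_Ioi
  have hd : ∀ x ∈ Set.Ioi (0:ℝ), HasDerivWithinAt (fun s => a / s) (-(a / x ^ 2)) (Set.Ioi 0) x := by
    intro x hx
    have hx0 : x ≠ 0 := ne_of_gt hx
    have := ((hasDerivAt_inv hx0).const_mul a).hasDerivWithinAt (s := Set.Ioi (0:ℝ))
    refine (this.congr_deriv ?_).congr_of_mem (fun y _ => div_eq_mul_inv a y) hx
    rw [div_eq_mul_inv]; ring
  have hanti : StrictAntiOn (fun s : ℝ => a / s) (Set.Ioi 0) := by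
    intro x hx y hy hxy
    exact div_lt_div_of_pos_left ha hx hxy
  have hmono : StrictMonoOn (fun s : ℝ => s - a / s) (Set.Ioi 0) := by
    intro x hx y hy hxy
    have := hanti hx hy hxy
    simp only at this ⊢
    linarith
  have him1 : (fun s : ℝ => a / s) '' Set.Ioi 0 = Set.Ioi 0 := by
    ext y
    simp only [Set.mem_image, Set.mem_Ioi]
    constructor
    · rintro ⟨x, hx, rfl⟩; positivity
    · intro hy
      exact ⟨a / y, by positivity, by field_simp⟩
  have him2 : (fun s : ℝ => s - a / s) '' Set.Ioi 0 = Set.univ := by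
    ext y
    simp only [Set.mem_image, Set.mem_Ioi, Set.mem_univ, iff_true]
    have hs : |y| < √(y ^ 2 + 4 * a) := by
      apply Real.lt_sqrt_of_sq_lt
      rw [sq_abs]; linarith
    have hpos : 0 < y + √(y ^ 2 + 4 * a) := by
      have := neg_abs_le y
      linarith
    refine ⟨(y + √(y ^ 2 + 4 * a)) / 2, by positivity, ?_⟩
    have hsq := Real.sq_sqrt (show 0 ≤ y ^ 2 + 4 * a by positivity)
    field_simp
    linear_combination hsq
  have e1 := lintegral_image_eq_lintegral_abs_deriv_mul measurableSet_Ioi hd hanti.injOn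
    (fun s => gE (s - a / s))
  have e2 := lintegral_image_eq_lintegral_abs_deriv_mul (f := fun s => s - a / s)
    (f' := fun x => 1 + a / x ^ 2) measurableSet_Ioi
    (by
      intro x hx
      have := (hasDerivWithinAt_id x (Set.Ioi 0)).sub (hd x hx)
      exact (this.congr_deriv (by ring)).congr_of_mem (fun y _ => rfl) hx) hmono.injOn gE
  rw [him1] at e1
  rw [him2, Measure.restrict_univ, lint_gE] at e2
  set J := ∫⁻ s in Set.Ioi (0:ℝ), gE (s - a / s) with hJ
  have e3 : ∫⁻ x in Set.Ioi (0:ℝ), ENNReal.ofReal |1 + a / x ^ 2| * gE (x - a / x) = J + J := by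
    conv_rhs => 
      congr
      · rw [hJ]
      · rw [e1]
    rw [← lintegral_add_left (by have := gE_meas; fun_prop)]
    refine setLIntegral_congr_fun measurableSet_Ioi ?_
    intro x hx
    have hx0 : (0:ℝ) < x := hx
    simp only
    have h1 : a / (a / x) = x := by field_simp
    rw [h1, ← gE_neg (a / x - x), neg_sub, abs_neg, abs_of_pos (by positivity), abs_of_pos (by positivity),
      ENNReal.ofReal_add (by positivity) (by positivity), ENNReal.ofReal_one, add_mul, one_mul]
  rw [e3] at e2
  rw [ENNReal.ofReal_div_of_pos two_pos, e2]
  simp only [ENNReal.ofReal_ofNat]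
  rw [← two_mul, mul_comm, ENNReal.mul_div_cancel_right two_ne_zero ENNReal.ofNat_ne_top]

def kk (c γ : ℝ) : ℝ :=
  if 0 < γ then Real.exp (-γ - c ^ 2 / (4 * γ) + c) / √(Real.pi * γ) else 0

lemma kk_meas (c : ℝ) : Measurable (kk c) := by
  unfold kk
  refine Measurable.ite measurableSet_Ioi ?_ ?_ <;> fun_prop

lemma lint_kk (c : ℝ) (hc : 0 ≤ c) : ∫⁻ γ, ENNReal.ofReal (kk c γ) = 1 := by
  have h0 : ∫⁻ γ, ENNReal.ofReal (kk c γ) = ∫⁻ γ in Set.Ioi (0:ℝ), ENNReal.ofReal (kk c γ) := by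
    rw [← lintegral_indicator measurableSet_Ioi]
    congr 1; ext γ
    by_cases h : 0 < γ
    · simp [h]
    · simp [h, kk]
  have him : (fun s : ℝ => s ^ 2) '' Set.Ioi 0 = Set.Ioi 0 := by
    ext y
    simp only [Set.mem_image, Set.mem_Ioi]
    constructor
    · rintro ⟨x, hx, rfl⟩; positivity
    · intro hy
      exact ⟨√y, by positivity, Real.sq_sqrt hy.le⟩
  have e1 := lintegral_image_eq_lintegral_abs_deriv_mul (f := fun s : ℝ => s ^ 2)
    (f' := fun x => 2 * x) measurableSet_Ioi
    (by
      intro x hx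
      simpa using (hasDerivAt_pow 2 x).hasDerivWithinAt (s := Set.Ioi (0:ℝ)))
    (by
      intro x hx y hy hxy
      exact (sq_eq_sq₀ (le_of_lt hx) (le_of_lt hy)).1 hxy) (fun γ => ENNReal.ofReal (kk c γ))
  rw [him] at e1
  rw [h0, e1]
  have hpi : 0 < √Real.pi := Real.sqrt_pos.2 Real.pi_pos
  have e2 : ∫⁻ x in Set.Ioi (0:ℝ), ENNReal.ofReal |2 * x| * ENNReal.ofReal (kk c (x ^ 2)) =
      ∫⁻ x in Set.Ioi (0:ℝ), ENNReal.ofReal (2 / √Real.pi) * gE (x - (c / 2) / x) := by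
    refine setLIntegral_congr_fun measurableSet_Ioi ?_
    intro x hx
    have hx0 : (0:ℝ) < x := hx
    simp only
    rw [gE, ← ENNReal.ofReal_mul (by positivity), ← ENNReal.ofReal_mul (by positivity)]
    congr 1
    rw [kk, if_pos (by positivity), abs_of_pos (by positivity), Real.sqrt_mul Real.pi_pos.le, Real.sqrt_sq hx0.le]
    have : -x ^ 2 - c ^ 2 / (4 * x ^ 2) + c = -(x - c / 2 / x) ^ 2 := by
      field_simp; ring
    rw [this]
    field_simp
  rw [e2, lintegral_const_mul _ (by have := gE_meas; fun_prop), glasser _ (by positivity),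
    ← ENNReal.ofReal_mul (by positivity)]
  rw [← ENNReal.ofReal_one]
  congr 1
  field_simp

section Aux
variable {V : Type*} [Fintype V] [DecidableEq V]

lemma Hmat_cont (W : Matrix V V ℝ) : Continuous (fun β : V → ℝ => Hmat W β) := by
  unfold Hmat
  have h : Continuous (fun β : V → ℝ => diagonal β) := Continuous.matrix_diagonal continuous_id
  exact (h.const_smul 2).sub continuous_const

lemma Hmat_apply (W : Matrix V V ℝ) (β : V → ℝ) (i j : V) :
    Hmat W β i j = 2 * (if i = j then β i else 0) - W i j := by
  simp only [Hmat, Matrix.sub_apply, Matrix.smul_apply, diagonal_apply]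
  simp

lemma Hmat_symm (W : Matrix V V ℝ) (hsymm : W.IsSymm) (β : V → ℝ) : (Hmat W β).IsHermitian := by
  rw [IsHermitian, conjTranspose_eq_transpose_of_trivial, Hmat, transpose_sub, hsymm.eq,
    transpose_smul, diagonal_transpose]

lemma inv_meas (W : Matrix V V ℝ) (i j : V) : Measurable (fun β : V → ℝ => (Hmat W β)⁻¹ i j) := by
  have h1 : Continuous (fun β : V → ℝ => (Hmat W β).det) := (Hmat_cont W).matrix_det
  have h2 : Continuous (fun β : V → ℝ => (Hmat W β).adjugate i j) :=
    (Hmat_cont W).matrix_adjugate.matrix_elem i j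
  simp only [inv_def, Matrix.smul_apply, Ring.inverse_eq_inv', smul_eq_mul]
  exact h1.measurable.inv.mul h2.measurable

lemma invQuad_meas (W : Matrix V V ℝ) (u v : V → ℝ) :
    Measurable (fun β : V → ℝ => u ⬝ᵥ (Hmat W β)⁻¹ *ᵥ v) := by
  simp only [dotProduct, mulVec]
  refine Finset.measurable_sum _ fun i _ => ?_
  refine Measurable.const_mul ?_ _
  refine Finset.measurable_sum _ fun j _ => ?_
  exact (inv_meas W i j).mul_const _

lemma posDef_meas (W : Matrix V V ℝ) (hsymm : W.IsSymm) :
    MeasurableSet {β : V → ℝ | (Hmat W β).PosDef} := by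
  have : {β : V → ℝ | (Hmat W β).PosDef} =
      {β : V → ℝ | ∀ x : V → ℝ, 0 ≤ x ⬝ᵥ Hmat W β *ᵥ x} ∩ {β | (Hmat W β).det ≠ 0} := by
    ext β
    simp only [Set.mem_ofPred_eq, Set.mem_inter_iff]
    constructor
    · intro h
      exact ⟨fun x => by simpa using h.posSemidef.dotProduct_mulVec_nonneg x, h.det_pos.ne'⟩
    · rintro ⟨h1, h2⟩
      have : (Hmat W β).PosSemidef :=
        PosSemidef.of_dotProduct_mulVec_nonneg (Hmat_symm W hsymm β) (fun x => by simpa using h1 x)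
      exact this.posDef_iff_det_ne_zero.2 h2
  rw [this]
  refine MeasurableSet.inter ?_ ?_
  · rw [Set.ofPred_forall]
    refine (isClosed_iInter fun x => ?_).measurableSet
    exact isClosed_le continuous_const (continuous_const.dotProduct ((Hmat_cont W).matrix_mulVec continuous_const))
  · exact ((Hmat_cont W).matrix_det.measurable (measurableSet_singleton 0)).compl

lemma nuDens_meas (W : Matrix V V ℝ) (hsymm : W.IsSymm) (η : V → ℝ) : Measurable (nuDens W η) := by
  unfold nuDens
  refine Measurable.indicator ?_ (posDef_meas W hsymm)
  have h1 := invQuad_meas W η η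
  have h2 : Measurable (fun β : V → ℝ => (1 : V → ℝ) ⬝ᵥ Hmat W β *ᵥ 1) :=
    (continuous_const.dotProduct ((Hmat_cont W).matrix_mulVec continuous_const)).measurable
  have h3 := (Hmat_cont W).matrix_det.measurable
  fun_prop

/-- Glue a value at `i₀` with values off `i₀`. -/
def glue (i₀ : V) (b : ℝ) (β : {i : V // i ≠ i₀} → ℝ) : V → ℝ :=
  fun i => if h : i = i₀ then b else β ⟨i, h⟩

/-- The splitting of `V` into `V ∖ {i₀}` and `i₀`. -/
def spl (i₀ : V) : {i : V // i ≠ i₀} ⊕ Unit ≃ V where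
  toFun := Sum.elim (fun i => i.1) (fun _ => i₀)
  invFun i := if h : i = i₀ then Sum.inr () else Sum.inl ⟨i, h⟩
  left_inv := by
    rintro (⟨i, hi⟩ | ⟨⟩)
    · simp [hi]
    · simp
  right_inv := by
    intro i
    by_cases h : i = i₀
    · simp [h]
    · simp [h]

@[simp] lemma spl_inl (i₀ : V) (i : {i : V // i ≠ i₀}) : spl i₀ (Sum.inl i) = i.1 := rfl
@[simp] lemma spl_inr (i₀ : V) (u : Unit) : spl i₀ (Sum.inr u) = i₀ := rfl
@[simp] lemma glue_self (i₀ : V) (b : ℝ) (β) : glue i₀ b β i₀ = b := by simp [glue]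
@[simp] lemma glue_val (i₀ : V) (b : ℝ) (β) (i : {i : V // i ≠ i₀}) : glue i₀ b β i.1 = β i := by
  simp [glue, i.2]

/-- Restriction of the weights. -/
def Wr (W : Matrix V V ℝ) (i₀ : V) : Matrix {i : V // i ≠ i₀} {i : V // i ≠ i₀} ℝ :=
  W.submatrix (fun i => i.1) (fun i => i.1)

/-- Weights towards `i₀`. -/
def wr (W : Matrix V V ℝ) (i₀ : V) : {i : V // i ≠ i₀} → ℝ := fun i => W i₀ i.1

lemma Hmat_glue (W : Matrix V V ℝ) (hsymm : W.IsSymm) (hdiag : ∀ i, W i i = 0) (i₀ : V)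
    (b : ℝ) (β : {i : V // i ≠ i₀} → ℝ) :
    (Hmat W (glue i₀ b β)).submatrix (spl i₀) (spl i₀) = blk (Hmat (Wr W i₀) β) (wr W i₀) (2 * b) := by
  ext i j
  rcases i with i | i <;> rcases j with j | j
  · simp [Hmat_apply, blk, Wr, Subtype.ext_iff]
  · simp [Hmat_apply, blk, wr, i.2, hsymm.apply]
  · simp [Hmat_apply, blk, wr, j.2.symm]
  · simp [Hmat_apply, blk, hdiag]

lemma lint_glue (i₀ : V) (G : (V → ℝ) → ENNReal) (hG : Measurable G) :
    ∫⁻ β, G β = ∫⁻ β : {i : V // i ≠ i₀} → ℝ, ∫⁻ b : ℝ, G (glue i₀ b β) := by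
  let p : V → Prop := fun i => i ≠ i₀
  have : Unique {i : V // ¬ p i} := ⟨⟨⟨i₀, by simp [p]⟩⟩, fun i => Subtype.ext (by simpa [p] using i.2)⟩
  have h1 := (volume_preserving_piEquivPiSubtypeProd (fun _ : V => ℝ) p).symm
  rw [← h1.lintegral_comp hG, Measure.volume_eq_prod, lintegral_prod _ (by
    exact (hG.comp (MeasurableEquiv.measurable _)).aemeasurable)]
  refine lintegral_congr fun β => ?_
  have h2 := (volume_preserving_funUnique {i : V // ¬ p i} ℝ).symm
  have h3 := h2.lintegral_comp
    (f := fun y => G ((MeasurableEquiv.piEquivPiSubtypeProd (fun _ => ℝ) p).symm (β, y))) (by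
    exact hG.comp ((MeasurableEquiv.measurable _).comp measurable_prodMk_left))
  refine Eq.trans ?_ (h3.symm.trans ?_)
  · congr!
  refine lintegral_congr fun b => ?_
  congr 1
  ext i
  by_cases h : i = i₀
  · subst h
    simp [MeasurableEquiv.piEquivPiSubtypeProd, p, MeasurableEquiv.funUnique, uniqueElim]
  · simp [MeasurableEquiv.piEquivPiSubtypeProd, p, h, glue]

lemma posDef_submatrix_iff {m n : Type*} (M : Matrix n n ℝ) (e : m ≃ n) :
    (M.submatrix e e).PosDef ↔ M.PosDef := by
  constructor
  · intro h
    simpa using h.submatrix e.symm.injective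
  · intro h
    exact h.submatrix e.injective

lemma quad_spl (i₀ : V) (M : Matrix V V ℝ) (u v : V → ℝ) :
    u ⬝ᵥ M *ᵥ v = (u ∘ spl i₀) ⬝ᵥ (M.submatrix (spl i₀) (spl i₀)) *ᵥ (v ∘ spl i₀) := by
  rw [submatrix_mulVec_equiv, Function.comp_assoc, Equiv.self_comp_symm, Function.comp_id,
    comp_equiv_dotProduct_comp_equiv]

lemma posDef_glue (W : Matrix V V ℝ) (hsymm : W.IsSymm) (hdiag : ∀ i, W i i = 0) (i₀ : V)
    (b : ℝ) (β : {i : V // i ≠ i₀} → ℝ) :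
    (Hmat W (glue i₀ b β)).PosDef ↔ (Hmat (Wr W i₀) β).PosDef ∧
      0 < 2 * b - wr W i₀ ⬝ᵥ (Hmat (Wr W i₀) β)⁻¹ *ᵥ wr W i₀ := by
  rw [← posDef_submatrix_iff _ (spl i₀), Hmat_glue W hsymm hdiag]
  constructor
  · intro h
    have hA : (Hmat (Wr W i₀) β).PosDef := by
      have := h.submatrix (e := Sum.inl) Sum.inl_injective
      exact this
    exact ⟨hA, (blk_posDef _ hA _ _).1 h⟩
  · rintro ⟨hA, h⟩
    exact (blk_posDef _ hA _ _).2 h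

/-- The shift. -/
def shf (W : Matrix V V ℝ) (i₀ : V) (β : {i : V // i ≠ i₀} → ℝ) : ℝ :=
  (wr W i₀ ⬝ᵥ (Hmat (Wr W i₀) β)⁻¹ *ᵥ wr W i₀) / 2

lemma inv_glue (W : Matrix V V ℝ) (hsymm : W.IsSymm) (hdiag : ∀ i, W i i = 0) (i₀ : V)
    (γ : ℝ) (hγ : 0 < γ) (β : {i : V // i ≠ i₀} → ℝ) (hA : (Hmat (Wr W i₀) β).PosDef) :
    1 / (2 * (Hmat W (glue i₀ (γ + shf W i₀ β) β))⁻¹ i₀ i₀) = γ := by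
  have h1 : (Hmat W (glue i₀ (γ + shf W i₀ β) β))⁻¹ i₀ i₀ =
      (blk (Hmat (Wr W i₀) β) (wr W i₀) (2 * (γ + shf W i₀ β)))⁻¹ (Sum.inr ()) (Sum.inr ()) := by
    rw [← Hmat_glue W hsymm hdiag, inv_submatrix_equiv]
    simp
  have h2 : 2 * (γ + shf W i₀ β) - wr W i₀ ⬝ᵥ (Hmat (Wr W i₀) β)⁻¹ *ᵥ wr W i₀ = 2 * γ := by
    rw [shf]; ring
  rw [h1, blk_inv_corner _ hA _ _ (by rw [h2]; positivity), h2]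
  field_simp

lemma nuDens_glue (W : Matrix V V ℝ) (hsymm : W.IsSymm) (hdiag : ∀ i, W i i = 0) (i₀ : V)
    (η : V → ℝ) (γ : ℝ) (β : {i : V // i ≠ i₀} → ℝ) :
    nuDens W η (glue i₀ (γ + shf W i₀ β) β) =
      ENNReal.ofReal (kk (η i₀ + wr W i₀ ⬝ᵥ (Hmat (Wr W i₀) β)⁻¹ *ᵥ (fun i => η i.1)) γ) *
        nuDens (Wr W i₀) (wr W i₀ + fun i => η i.1) β := by
  have h2 : 2 * (γ + shf W i₀ β) - wr W i₀ ⬝ᵥ (Hmat (Wr W i₀) β)⁻¹ *ᵥ wr W i₀ = 2 * γ := by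
    rw [shf]; ring
  have hP := posDef_glue W hsymm hdiag i₀ (γ + shf W i₀ β) β
  rw [h2] at hP
  by_cases hA : (Hmat (Wr W i₀) β).PosDef
  swap
  · have : ¬ (Hmat W (glue i₀ (γ + shf W i₀ β) β)).PosDef := fun h => hA (hP.1 h).1
    rw [nuDens, nuDens, Set.indicator_of_notMem (by exact this), Set.indicator_of_notMem (by exact hA), mul_zero]
  by_cases hγ : 0 < γ
  swap
  · have : ¬ (Hmat W (glue i₀ (γ + shf W i₀ β) β)).PosDef := fun h => hγ (by linarith [(hP.1 h).2])
    rw [nuDens, Set.indicator_of_notMem (by exact this), kk, if_neg hγ]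
    simp
  have hM : (Hmat W (glue i₀ (γ + shf W i₀ β) β)).PosDef := hP.2 ⟨hA, by positivity⟩
  rw [nuDens, nuDens, Set.indicator_of_mem (by exact hM), Set.indicator_of_mem (by exact hA),
    kk, if_pos hγ, ← ENNReal.ofReal_mul (by positivity)]
  congr 1
  have hsp : η ∘ spl i₀ = Sum.elim (fun i => η i.1) (fun _ => η i₀) := by
    ext i; rcases i with i | i <;> rfl
  have hone : (1 : V → ℝ) ∘ spl i₀ = 1 := rfl
  have hsum : η ⬝ᵥ (1 : V → ℝ) = (fun i : {i : V // i ≠ i₀} => η i.1) ⬝ᵥ 1 + η i₀ := by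
    rw [← comp_equiv_dotProduct_comp_equiv _ _ (spl i₀), hsp, hone]
    simp [dotProduct]
  have hcard : (Fintype.card V : ℝ) = Fintype.card {i : V // i ≠ i₀} + 1 := by
    rw [← Fintype.card_congr (spl i₀)]; simp
  have hdet : (Hmat W (glue i₀ (γ + shf W i₀ β) β)).det = (Hmat (Wr W i₀) β).det * (2 * γ) := by
    rw [← det_submatrix_equiv_self (spl i₀), Hmat_glue W hsymm hdiag, blk_det _ hA, h2]
  rw [quad_spl i₀, quad_spl i₀ _ η η, ← inv_submatrix_equiv, Hmat_glue W hsymm hdiag, hone, hsp,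
    blk_one_quad, blk_inv_quad _ hA _ _ (by rw [h2]; positivity), h2, hsum, hcard, hdet]
  set A := Hmat (Wr W i₀) β with hAdef
  set w := wr W i₀ with hw
  set u : {i : V // i ≠ i₀} → ℝ := fun i => η i.1 with hu
  have hs : 2 * (γ + shf W i₀ β) = 2 * γ + w ⬝ᵥ A⁻¹ *ᵥ w := by linarith
  rw [hs]
  have hsym : u ⬝ᵥ A⁻¹ *ᵥ w = w ⬝ᵥ A⁻¹ *ᵥ u := by
    rw [dotProduct_mulVec, ← mulVec_transpose, dotProduct_comm]
    have := hA.isHermitian.inv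
    rw [IsHermitian, conjTranspose_eq_transpose_of_trivial] at this
    rw [this]
  have hexp : (w + u) ⬝ᵥ A⁻¹ *ᵥ (w + u) = w ⬝ᵥ A⁻¹ *ᵥ w + 2 * (w ⬝ᵥ A⁻¹ *ᵥ u) + u ⬝ᵥ A⁻¹ *ᵥ u := by
    rw [mulVec_add, dotProduct_add, add_dotProduct, add_dotProduct, hsym]; ring
  rw [hexp, add_dotProduct w u 1]
  generalize w ⬝ᵥ A⁻¹ *ᵥ w = q1
  generalize w ⬝ᵥ A⁻¹ *ᵥ u = q2
  generalize u ⬝ᵥ A⁻¹ *ᵥ u = q3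
  generalize w ⬝ᵥ 1 = q4
  generalize u ⬝ᵥ 1 = q5
  generalize 1 ⬝ᵥ A *ᵥ 1 = q6
  generalize (Fintype.card {i : V // i ≠ i₀} : ℝ) = n
  have hdp := hA.det_pos
  generalize A.det = D at hdp
  have hpi := Real.pi_pos
  rw [add_div, Real.rpow_add (by positivity), ← Real.sqrt_eq_rpow, Real.sqrt_div two_pos.le,
    Real.sqrt_mul hdp.le, Real.sqrt_mul two_pos.le, Real.sqrt_mul hpi.le]
  have hE : Real.exp (-(1 / 2) * (q6 - 2 * q4 + (2 * γ + q1) + (q3 + (η i₀ + q2) ^ 2 / (2 * γ))) + (q5 + η i₀))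
     = Real.exp (-γ - (η i₀ + q2) ^ 2 / (4 * γ) + (η i₀ + q2)) *
       Real.exp (-(1 / 2) * (q6 + (q1 + 2 * q2 + q3)) + (q4 + q5)) := by
    rw [← Real.exp_add]
    congr 1
    field_simp
    ring
  rw [hE]
  field_simp

end Aux

universe u

lemma nuDens_mass (n : ℕ) : ∀ {V : Type u} [Fintype V] [DecidableEq V] (_ : Fintype.card V = n)
    (W : Matrix V V ℝ) (_ : W.IsSymm) (_ : ∀ i j, 0 ≤ W i j)
    (_ : ∀ i, W i i = 0) (η : V → ℝ) (_ : ∀ i, 0 ≤ η i), ∫⁻ β, nuDens W η β = 1 := by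
  induction n with
  | zero =>
    intro V _ _ hc W hsymm hnn hdiag η hη
    have : IsEmpty V := Fintype.card_eq_zero_iff.1 hc
    rw [lintegral_unique, volume_pi, Measure.pi_of_empty]
    have : ∀ β, (Hmat W β).PosDef := by
      intro β
      refine PosDef.of_dotProduct_mulVec_pos (Hmat_symm W hsymm _) fun x hx => ?_
      exact absurd (Subsingleton.elim x 0) hx
    rw [nuDens, Set.indicator_of_mem (by exact this _)]
    simp [dotProduct]
  | succ n ih =>
    intro V _ _ hc W hsymm hnn hdiag η hη
    have : Nonempty V := Fintype.card_pos_iff.1 (by omega)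
    obtain ⟨i₀⟩ := this
    rw [lint_glue i₀ _ (nuDens_meas W hsymm η)]
    have hoff : ∀ β, ∀ i j, i ≠ j → Hmat (Wr W i₀) β i j ≤ 0 := by
      intro β i j hij
      simp [Hmat_apply, hij, Wr, hnn]
    have : ∀ β : {i : V // i ≠ i₀} → ℝ, ∫⁻ b, nuDens W η (glue i₀ b β) =
        nuDens (Wr W i₀) (wr W i₀ + fun i => η i.1) β := by
      intro β
      rw [← lintegral_add_right_eq_self _ (shf W i₀ β)]
      simp only [nuDens_glue W hsymm hdiag]
      rw [lintegral_mul_const _ (kk_meas _).ennreal_ofReal]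
      by_cases hA : (Hmat (Wr W i₀) β).PosDef
      · rw [lint_kk, one_mul]
        refine add_nonneg (hη _) (Finset.sum_nonneg fun i _ => mul_nonneg (hnn _ _) ?_)
        exact inv_nonneg_of_offdiag _ hA (hoff β) _ (fun i => hη _) i
      · rw [nuDens, Set.indicator_of_notMem (by exact hA), mul_zero]
    simp only [this]
    refine ih ?_ _ (hsymm.submatrix _) (fun i j => hnn _ _) (fun i => hdiag _) _
      (fun i => add_nonneg (hnn _ _) (hη _))
    have := Fintype.card_congr (spl i₀)
    simp at this
    rw [hc] at this
    have h2 : 0 < Fintype.card V := by omega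
    simp
    omega

section Main
variable {V : Type*} [Fintype V] [DecidableEq V]

/-- The law of `γ`. -/
def gam : Measure ℝ := volume.withDensity (fun γ => ENNReal.ofReal (kk 0 γ))

instance gam_prob : IsProbabilityMeasure gam := ⟨by
  rw [gam, withDensity_apply _ MeasurableSet.univ, Measure.restrict_univ, lint_kk 0 le_rfl]⟩

lemma nuMeas_prob (W : Matrix V V ℝ) (hsymm : W.IsSymm) (hnn : ∀ i j, 0 ≤ W i j)
    (hdiag : ∀ i, W i i = 0) (η : V → ℝ) (hη : ∀ i, 0 ≤ η i) : IsProbabilityMeasure (nuMeas W η) := ⟨by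
  rw [nuMeas, withDensity_apply _ MeasurableSet.univ, Measure.restrict_univ,
    nuDens_mass _ rfl W hsymm hnn hdiag η hη]⟩

lemma gfun_meas (W : Matrix V V ℝ) (i₀ : V) :
    Measurable (fun β : V → ℝ => 1 / (2 * (Hmat W β)⁻¹ i₀ i₀)) :=
  ((inv_meas W i₀ i₀).const_mul 2).const_div 1

lemma joint (W : Matrix V V ℝ) (hsymm : W.IsSymm) (hnn : ∀ i j, 0 ≤ W i j)
    (hdiag : ∀ i, W i i = 0) (i₀ : V) :
    Measure.map (fun β : V → ℝ => (1 / (2 * (Hmat W β)⁻¹ i₀ i₀), fun i : {i : V // i ≠ i₀} => β i.1))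
      (nuMeas W 0) = gam.prod (nuMeas (Wr W i₀) (wr W i₀)) := by
  have hs' : (Wr W i₀).IsSymm := hsymm.submatrix _
  have := nuMeas_prob (Wr W i₀) hs' (fun i j => hnn _ _) (fun i => hdiag _) (wr W i₀) (fun i => hnn _ _)
  have hT : Measurable (fun β : V → ℝ => (1 / (2 * (Hmat W β)⁻¹ i₀ i₀), fun i : {i : V // i ≠ i₀} => β i.1)) :=
    (gfun_meas W i₀).prodMk (by fun_prop)
  refine Measure.ext_of_lintegral _ fun F hF => ?_
  refine (lintegral_map hF hT).trans ?_
  refine (lintegral_withDensity_eq_lintegral_mul _ (nuDens_meas W hsymm 0) (hF.comp hT)).trans ?_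
  rw [lint_glue i₀ _ ((nuDens_meas W hsymm 0).mul (hF.comp hT)),
    lintegral_prod_symm _ hF.aemeasurable, nuMeas,
    lintegral_withDensity_eq_lintegral_mul _ (nuDens_meas _ hs' _) hF.lintegral_prod_left']
  refine lintegral_congr fun β => ?_
  rw [← lintegral_add_right_eq_self _ (shf W i₀ β), Pi.mul_apply, gam,
    lintegral_withDensity_eq_lintegral_mul _ (kk_meas 0).ennreal_ofReal (by fun_prop),
    ← lintegral_const_mul _ (by
      exact (kk_meas 0).ennreal_ofReal.mul (by fun_prop))]
  refine lintegral_congr fun γ => ?_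
  simp only [Pi.mul_apply, nuDens_glue W hsymm hdiag]
  have e0 : (fun i : {i : V // i ≠ i₀} => (0 : V → ℝ) i.1) = 0 := rfl
  rw [e0, mulVec_zero, dotProduct_zero, Pi.zero_apply, add_zero, add_zero]
  by_cases hA : (Hmat (Wr W i₀) β).PosDef
  swap
  · rw [nuDens, Set.indicator_of_notMem (by exact hA)]; simp
  by_cases hγ : 0 < γ
  swap
  · rw [kk, if_neg hγ]; simp
  rw [Function.comp_apply, inv_glue W hsymm hdiag i₀ γ hγ β hA]
  simp only [glue_val]
  ring

end Main

theorem stmt7 {V : Type*} [Fintype V] [DecidableEq V] [Nonempty V]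
    (W : Matrix V V ℝ) (hsymm : W.IsSymm) (hnn : ∀ i j, 0 ≤ W i j)
    (hdiag : ∀ i, W i i = 0) (hconn : (graphOf W).Connected)
    (i₀ : V) :
    Measure.map (fun β : V → ℝ => 1 / (2 * (Hmat W β)⁻¹ i₀ i₀)) (nuMeas W 0)
      = volume.withDensity (fun γ : ℝ =>
          ENNReal.ofReal (if 0 < γ then Real.exp (-γ) / Real.sqrt (Real.pi * γ) else 0))
    ∧ ProbabilityTheory.IndepFun
        (fun β : V → ℝ => 1 / (2 * (Hmat W β)⁻¹ i₀ i₀))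
        (fun (β : V → ℝ) (i : {i : V // i ≠ i₀}) => β i.1)
        (nuMeas W 0) := by
  have hp := nuMeas_prob W hsymm hnn hdiag 0 (fun _ => le_rfl)
  have hp' := nuMeas_prob (Wr W i₀) (hsymm.submatrix _) (fun i j => hnn _ _) (fun i => hdiag _) (wr W i₀)
    (fun i => hnn _ _)
  have hj := joint W hsymm hnn hdiag i₀
  have hg := gfun_meas W i₀
  have hr : Measurable (fun (β : V → ℝ) (i : {i : V // i ≠ i₀}) => β i.1) := by fun_prop
  have h1 : Measure.map (fun β : V → ℝ => 1 / (2 * (Hmat W β)⁻¹ i₀ i₀)) (nuMeas W 0) = gam := by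
    have := congrArg Measure.fst hj
    rwa [Measure.fst_map_prodMk hr, Measure.fst_prod] at this
  have h2 : Measure.map (fun (β : V → ℝ) (i : {i : V // i ≠ i₀}) => β i.1) (nuMeas W 0) =
      nuMeas (Wr W i₀) (wr W i₀) := by
    have := congrArg Measure.snd hj
    rwa [Measure.snd_map_prodMk hg, Measure.snd_prod] at this
  refine ⟨?_, ?_⟩
  · rw [h1, gam]
    congr 1
    ext γ
    simp [kk]
  · rw [ProbabilityTheory.indepFun_iff_map_prod_eq_prod_map_map hg.aemeasurable hr.aemeasurable, h1, h2]
    exact hj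

end
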